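/- arXiv:1004.1529 — 8 statements merged into one kernel-verified Lean document; each statement's English description precedes it below -/
import Mathlib

section
/- Let F = ℝ(x,y) be the field of fractions of the polynomial ring ℝ[x,y] in two variables. If s₀, s₁, s₂, s₃ ∈ F are each sums of squares of elements of F (i.e. each sᵢ is a finite sum Σⱼ tᵢⱼ² with tᵢⱼ ∈ F) and they satisfy s₀·x·y = s₁ + s₂·x + s₃·y (where x, y denote the images of the two variables in F), then s₀ = s₁ = s₂ = s₃ = 0. -/
open MvPolynomial

/-- `F = ℝ(x,y)`, the field of fractions of `ℝ[x,y]`. -/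
noncomputable abbrev F2 : Type := FractionRing (MvPolynomial (Fin 2) ℝ)

/-- The image of the variable `x` in `F = ℝ(x,y)`. -/
noncomputable def F2x : F2 := algebraMap (MvPolynomial (Fin 2) ℝ) F2 (X 0)

/-- The image of the variable `y` in `F = ℝ(x,y)`. -/
noncomputable def F2y : F2 := algebraMap (MvPolynomial (Fin 2) ℝ) F2 (X 1)

/-- `s` is a (finite) sum of squares of elements of `K`. -/
def IsSumOfSquares {K : Type*} [CommRing K] (s : K) : Prop :=
  ∃ (n : ℕ) (t : Fin n → K), s = ∑ i, t i ^ 2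


namespace Stmt0Aux

abbrev P2 := MvPolynomial (Fin 2) ℝ

noncomputable abbrev mo : MonomialOrder (Fin 2) := MonomialOrder.lex

/-- sums of squares of polynomials have an even leading exponent -/
lemma sumSq_degree {p : P2} (hp : IsSumSq p) :
    p = 0 ∨ ((∀ i, mo.degree p i % 2 = 0) ∧ 0 < mo.leadingCoeff p) := by
  induction hp with
  | zero => left; rfl
  | sq_add a hs ih =>
    rename_i s
    by_cases ha : a = 0
    · subst ha; simpa using ih
    right
    have hd : mo.degree (a * a) = mo.degree a + mo.degree a := mo.degree_mul ha ha
    have hl : 0 < mo.leadingCoeff (a * a) := by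
      rw [mo.leadingCoeff_mul]
      exact mul_self_pos.mpr (mo.leadingCoeff_ne_zero_iff.mpr ha)
    have hev : ∀ i, mo.degree (a * a) i % 2 = 0 := by
      intro i; rw [hd, Finsupp.add_apply]; omega
    rcases ih with rfl | ⟨h1, h2⟩
    · rw [add_zero]; exact ⟨hev, hl⟩
    rcases lt_trichotomy (mo.toSyn (mo.degree (a * a))) (mo.toSyn (mo.degree s)) with h | h | h
    · rw [add_comm, mo.degree_add_of_lt h, mo.leadingCoeff_add_of_lt h]; exact ⟨h1, h2⟩
    · have h' : mo.degree (a * a) = mo.degree s := mo.toSyn.injective h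
      have hc : 0 < (a * a + s).coeff (mo.degree (a * a)) := by
        rw [MvPolynomial.coeff_add]
        refine add_pos hl ?_
        rw [h']; exact h2
      have hdd : mo.degree (a * a + s) = mo.degree (a * a) := by
        apply mo.toSyn.injective
        apply le_antisymm
        · refine le_trans mo.degree_add_le ?_
          rw [h, sup_idem]
        · exact mo.le_degree (MvPolynomial.mem_support_iff.mpr hc.ne')
      refine ⟨by rw [hdd]; exact hev, ?_⟩
      unfold MonomialOrder.leadingCoeff
      rw [hdd]; exact hc
    · rw [mo.degree_add_of_lt h, mo.leadingCoeff_add_of_lt h]; exact ⟨hev, hl⟩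

/-- parity of the `i`-th leading exponent -/
def Par (i : Fin 2) (a : ℕ) (p : P2) : Prop := p = 0 ∨ mo.degree p i % 2 = a

lemma Par.neg {i a p} (h : Par i a p) : Par i a (-p) := by
  rcases h with rfl | h
  · left; simp
  · right; rwa [mo.degree_neg]

lemma sumSq_par {p : P2} (hp : IsSumSq p) (i) : Par i 0 p := by
  rcases sumSq_degree hp with h | h
  · exact Or.inl h
  · exact Or.inr (h.1 i)

lemma Par.mul_X {i a p} (h : Par i a p) (j : Fin 2) :
    Par i ((a + if i = j then 1 else 0) % 2) (p * X j) := by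
  by_cases hp : p = 0
  · left; simp [hp]
  have h := h.resolve_left hp
  right
  rw [mo.degree_mul hp (X_ne_zero j), mo.degree_X, Finsupp.add_apply, Finsupp.single_apply, ← h]
  simp only [eq_comm (a := i)]
  omega

lemma Par.eq_zero {i a b p} (h : Par i a p) (h' : Par i b p) (hab : a ≠ b) : p = 0 := by
  rcases h with h | h
  · exact h
  rcases h' with h' | h'
  · exact h'
  · exact absurd (h.symm.trans h') hab

lemma Par.add {i j a b c p q} (hp : Par i a p) (hq : Par i b q) (hab : a ≠ b)
    (hp' : Par j c p) (hq' : Par j c q) : Par j c (p + q) := by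
  by_cases p0 : p = 0
  · rwa [p0, zero_add]
  by_cases q0 : q = 0
  · rwa [q0, add_zero]
  have hne : mo.degree p ≠ mo.degree q := by
    intro h
    have h1 := hp.resolve_left p0
    have h2 := hq.resolve_left q0
    rw [h] at h1
    exact hab (h1.symm.trans h2)
  rcases lt_or_gt_of_ne (fun h => hne (mo.toSyn.injective h)) with h | h
  · right; rw [add_comm, mo.degree_add_of_lt h]; exact hq'.resolve_left q0
  · right; rw [mo.degree_add_of_lt h]; exact hp'.resolve_left p0

lemma poly_case {p₀ p₁ p₂ p₃ : P2} (h₀ : IsSumSq p₀) (h₁ : IsSumSq p₁) (h₂ : IsSumSq p₂)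
    (h₃ : IsSumSq p₃) (h : p₀ * X 0 * X 1 = p₁ + p₂ * X 0 + p₃ * X 1) :
    p₀ = 0 ∧ p₁ = 0 ∧ p₂ = 0 ∧ p₃ = 0 := by
  have a1 : Par 1 0 (p₁ + p₂ * X 0) :=
    Par.add (sumSq_par h₁ 0) ((sumSq_par h₂ 0).mul_X 0) (by simp) (sumSq_par h₁ 1)
      (by simpa using (sumSq_par h₂ 1).mul_X 0)
  have a2 : Par 1 0 (p₀ * X 0 + -p₃) :=
    Par.add ((sumSq_par h₀ 0).mul_X 0) (sumSq_par h₃ 0).neg (by simp)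
      (by simpa using (sumSq_par h₀ 1).mul_X 0) (sumSq_par h₃ 1).neg
  have e : p₁ + p₂ * X 0 = (p₀ * X 0 + -p₃) * X 1 := by linear_combination -h
  have z : p₁ + p₂ * X 0 = 0 := by
    refine a1.eq_zero (b := 1) ?_ (by simp)
    rw [e]; simpa using a2.mul_X 1
  have z' : p₀ * X 0 + -p₃ = 0 := by
    rw [z] at e
    exact (mul_eq_zero.mp e.symm).resolve_right (X_ne_zero 1)
  have key : ∀ {p q : P2}, IsSumSq p → IsSumSq q → p = q * X 0 → q = 0 := by
    intro p q hp hq hpq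
    have : p = 0 := by
      refine (sumSq_par hp 0).eq_zero (b := 1) ?_ (by simp)
      rw [hpq]; simpa using (sumSq_par hq 0).mul_X 0
    rw [this] at hpq
    exact (mul_eq_zero.mp hpq.symm).resolve_right (X_ne_zero 0)
  have r0 : p₀ = 0 := key h₃ h₀ (by linear_combination -z')
  have r2 : p₂ = 0 := by
    have hn : Par 0 0 (p₂ * X 0) := by
      rw [show p₂ * X 0 = -p₁ by linear_combination z]; exact (sumSq_par h₁ 0).neg
    have := hn.eq_zero ((sumSq_par h₂ 0).mul_X 0) (by simp)
    exact (mul_eq_zero.mp this).resolve_right (X_ne_zero 0)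
  subst r0 r2
  exact ⟨rfl, by simpa using z, rfl, by simpa using z'⟩

lemma clear_denom {s : F2} (h : IsSumOfSquares s) :
    ∃ q : P2, q ≠ 0 ∧ ∃ p : P2, IsSumSq p ∧ s * algebraMap P2 F2 q ^ 2 = algebraMap P2 F2 p := by
  obtain ⟨n, t, rfl⟩ := h
  obtain ⟨b, hb⟩ := IsLocalization.exist_integer_multiples_of_finite (nonZeroDivisors P2) t
  choose c hc using hb
  refine ⟨b, nonZeroDivisors.ne_zero b.2, ∑ i, c i * c i, IsSumSq.sum_mul_self _ _, ?_⟩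
  rw [map_sum, Finset.sum_mul]
  refine Finset.sum_congr rfl fun i _ => ?_
  rw [map_mul, hc i, Algebra.smul_def]
  ring

lemma scale {s : F2} {q p : P2} (r : P2) (hp : IsSumSq p)
    (h : s * algebraMap P2 F2 q ^ 2 = algebraMap P2 F2 p) :
    ∃ p' : P2, IsSumSq p' ∧ s * algebraMap P2 F2 (q * r) ^ 2 = algebraMap P2 F2 p' := by
  refine ⟨p * (r * r), hp.mul (IsSumSq.mul_self r), ?_⟩
  rw [map_mul, map_mul, map_mul, ← h]; ring

end Stmt0Aux

open Stmt0Aux in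
theorem stmt0 (s₀ s₁ s₂ s₃ : F2)
    (h₀ : IsSumOfSquares s₀) (h₁ : IsSumOfSquares s₁)
    (h₂ : IsSumOfSquares s₂) (h₃ : IsSumOfSquares s₃)
    (heq : s₀ * F2x * F2y = s₁ + s₂ * F2x + s₃ * F2y) :
    s₀ = 0 ∧ s₁ = 0 ∧ s₂ = 0 ∧ s₃ = 0 := by
  obtain ⟨q₀, n₀, p₀, g₀, e₀⟩ := clear_denom h₀
  obtain ⟨q₁, n₁, p₁, g₁, e₁⟩ := clear_denom h₁
  obtain ⟨q₂, n₂, p₂, g₂, e₂⟩ := clear_denom h₂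
  obtain ⟨q₃, n₃, p₃, g₃, e₃⟩ := clear_denom h₃
  obtain ⟨r₀, k₀, f₀⟩ := scale (q₁ * q₂ * q₃) g₀ e₀
  obtain ⟨r₁, k₁, f₁⟩ := scale (q₀ * q₂ * q₃) g₁ e₁
  obtain ⟨r₂, k₂, f₂⟩ := scale (q₀ * q₁ * q₃) g₂ e₂
  obtain ⟨r₃, k₃, f₃⟩ := scale (q₀ * q₁ * q₂) g₃ e₃
  rw [show q₁ * (q₀ * q₂ * q₃) = q₀ * (q₁ * q₂ * q₃) by ring] at f₁
  rw [show q₂ * (q₀ * q₁ * q₃) = q₀ * (q₁ * q₂ * q₃) by ring] at f₂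
  rw [show q₃ * (q₀ * q₁ * q₂) = q₀ * (q₁ * q₂ * q₃) by ring] at f₃
  have hQ : q₀ * (q₁ * q₂ * q₃) ≠ 0 := by simp [n₀, n₁, n₂, n₃]
  generalize q₀ * (q₁ * q₂ * q₃) = Q at *
  have inj : Function.Injective (algebraMap P2 F2) := IsFractionRing.injective P2 F2
  have hQ' : algebraMap P2 F2 Q ^ 2 ≠ 0 :=
    pow_ne_zero 2 ((map_ne_zero_iff _ inj).mpr hQ)
  have main : r₀ * X 0 * X 1 = r₁ + r₂ * X 0 + r₃ * X 1 := by
    apply inj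
    simp only [map_add, map_mul, ← f₀, ← f₁, ← f₂, ← f₃]
    change _ * F2x * F2y = _ + _ * F2x + _ * F2y
    linear_combination (algebraMap P2 F2 Q ^ 2) * heq
  obtain ⟨z₀, z₁, z₂, z₃⟩ := poly_case k₀ k₁ k₂ k₃ main
  rw [z₀, map_zero] at f₀
  rw [z₁, map_zero] at f₁
  rw [z₂, map_zero] at f₂
  rw [z₃, map_zero] at f₃
  exact ⟨(mul_eq_zero.mp f₀).resolve_right hQ', (mul_eq_zero.mp f₁).resolve_right hQ',
    (mul_eq_zero.mp f₂).resolve_right hQ', (mul_eq_zero.mp f₃).resolve_right hQ'⟩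
end

section
/- If s₀, s₁, s₂, s₃ ∈ ℝ[x,y] are each sums of squares of polynomials (i.e. each sᵢ is a finite sum Σⱼ pᵢⱼ² with pᵢⱼ ∈ ℝ[x,y]) and they satisfy s₀·x·y = s₁ + s₂·x + s₃·y, then s₀ = s₁ = s₂ = s₃ = 0. -/
open MvPolynomial

/-- The leading exponent of a nonzero sum of squares is even. -/
lemma sos_degree (m : MonomialOrder (Fin 2)) (s : MvPolynomial (Fin 2) ℝ)
    (h : IsSumOfSquares s) (hs : s ≠ 0) : ∃ d, m.degree s = d + d := by
  classical
  obtain ⟨n, t, rfl⟩ := h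
  have hne : (Finset.univ.filter (fun i => t i ≠ 0)).Nonempty := by
    by_contra hcon
    apply hs
    apply Finset.sum_eq_zero
    intro i _
    have : t i = 0 := by
      by_contra hi
      exact hcon ⟨i, by simp [hi]⟩
    simp [this]
  obtain ⟨i, hi, hmax⟩ := Finset.exists_max_image _ (fun i => m.toSyn (m.degree (t i))) hne
  have hi0 : t i ≠ 0 := by simpa using hi
  have hle : ∀ j, m.toSyn (m.degree (t j)) ≤ m.toSyn (m.degree (t i)) := by
    intro j
    by_cases hj : t j = 0
    · rw [hj, MonomialOrder.degree_zero, map_zero]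
      exact bot_le
    · exact hmax j (by simp [hj])
  refine ⟨m.degree (t i), ?_⟩
  have hc : coeff (m.degree (t i) + m.degree (t i)) (∑ j, t j ^ 2) ≠ 0 := by
    rw [coeff_sum]
    have : ∀ j, coeff (m.degree (t i) + m.degree (t i)) (t j ^ 2)
        = coeff (m.degree (t i)) (t j) ^ 2 := by
      intro j
      rw [sq, sq, m.coeff_mul_of_add_of_degree_le (hle j) (hle j)]
    simp_rw [this]
    apply ne_of_gt
    apply Finset.sum_pos' (fun j _ => sq_nonneg _)
    refine ⟨i, Finset.mem_univ _, ?_⟩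
    have : coeff (m.degree (t i)) (t i) ≠ 0 := m.leadingCoeff_ne_zero_iff.mpr hi0
    positivity
  apply m.toSyn.injective
  apply le_antisymm
  · rw [MonomialOrder.degree_le_iff]
    intro c hcs
    by_contra hlt
    rw [not_le] at hlt
    rw [mem_support_iff, coeff_sum] at hcs
    apply hcs
    apply Finset.sum_eq_zero
    intro j _
    apply m.coeff_eq_zero_of_lt
    refine lt_of_le_of_lt ?_ hlt
    rw [sq]
    refine m.degree_mul_le.trans ?_
    rw [map_add, map_add]
    exact add_le_add (hle j) (hle j)
  · exact m.le_degree (mem_support_iff.mpr hc)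

/-- Polynomials with pairwise distinct leading exponents and zero sum all vanish. -/
lemma all_zero_of_distinct (m : MonomialOrder (Fin 2)) (f : Fin 4 → MvPolynomial (Fin 2) ℝ)
    (hf : ∀ i j, f i ≠ 0 → f j ≠ 0 → m.degree (f i) = m.degree (f j) → i = j)
    (hsum : ∑ i, f i = 0) (k : Fin 4) : f k = 0 := by
  classical
  by_contra hk
  obtain ⟨i, hi, hmax⟩ := Finset.exists_max_image (Finset.univ.filter (fun i => f i ≠ 0))
    (fun i => m.toSyn (m.degree (f i))) ⟨k, by simp [hk]⟩
  have hi0 : f i ≠ 0 := by simpa using hi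
  have hc := congrArg (coeff (m.degree (f i))) hsum
  rw [coeff_sum, Finset.sum_eq_single i] at hc
  · exact m.leadingCoeff_ne_zero_iff.mpr hi0 (by simpa using hc)
  · intro j _ hji
    by_cases hj : f j = 0
    · simp [hj]
    · apply m.coeff_eq_zero_of_lt
      refine lt_of_le_of_ne (hmax j (by simp [hj])) ?_
      intro h
      exact hji (hf j i hj hi0 (m.toSyn.injective h))
  · simp

theorem stmt1 (s₀ s₁ s₂ s₃ : MvPolynomial (Fin 2) ℝ)
    (h₀ : IsSumOfSquares s₀) (h₁ : IsSumOfSquares s₁)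
    (h₂ : IsSumOfSquares s₂) (h₃ : IsSumOfSquares s₃)
    (heq : s₀ * X 0 * X 1 = s₁ + s₂ * X 0 + s₃ * X 1) :
    s₀ = 0 ∧ s₁ = 0 ∧ s₂ = 0 ∧ s₃ = 0 := by
  let m : MonomialOrder (Fin 2) := MonomialOrder.lex
  have hX : ∀ i : Fin 2, (X i : MvPolynomial (Fin 2) ℝ) ≠ 0 := fun i => X_ne_zero i
  let f : Fin 4 → MvPolynomial (Fin 2) ℝ := ![-(s₀ * X 0 * X 1), s₁, s₂ * X 0, s₃ * X 1]
  have hpar : ∀ i, f i ≠ 0 →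
      m.degree (f i) 0 % 2 = (![1, 0, 1, 0] : Fin 4 → ℕ) i ∧
      m.degree (f i) 1 % 2 = (![1, 0, 0, 1] : Fin 4 → ℕ) i := by
    intro i
    fin_cases i
    · intro h
      have hs : s₀ ≠ 0 := by rintro rfl; simp [f] at h
      obtain ⟨d, hd⟩ := sos_degree m s₀ h₀ hs
      simp only [f, Fin.zero_eta, Matrix.cons_val_zero, MonomialOrder.degree_neg]
      rw [m.degree_mul (mul_ne_zero hs (hX 0)) (hX 1), m.degree_mul hs (hX 0), hd,
        MonomialOrder.degree_X, MonomialOrder.degree_X]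
      simp [Finsupp.single_apply]
      omega
    · intro h
      obtain ⟨d, hd⟩ := sos_degree m s₁ h₁ h
      change m.degree s₁ 0 % 2 = 0 ∧ m.degree s₁ 1 % 2 = 0
      rw [hd]
      simp
      omega
    · intro h
      have hs : s₂ ≠ 0 := by rintro rfl; simp [f] at h
      obtain ⟨d, hd⟩ := sos_degree m s₂ h₂ hs
      change m.degree (s₂ * X 0) 0 % 2 = 1 ∧ m.degree (s₂ * X 0) 1 % 2 = 0
      rw [m.degree_mul hs (hX 0), hd, MonomialOrder.degree_X]
      simp [Finsupp.single_apply]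
      omega
    · intro h
      have hs : s₃ ≠ 0 := by rintro rfl; simp [f] at h
      obtain ⟨d, hd⟩ := sos_degree m s₃ h₃ hs
      change m.degree (s₃ * X 1) 0 % 2 = 0 ∧ m.degree (s₃ * X 1) 1 % 2 = 1
      rw [m.degree_mul hs (hX 1), hd, MonomialOrder.degree_X]
      simp [Finsupp.single_apply]
      omega
  have key := all_zero_of_distinct m f (by
    intro i j hi hj hij
    have a := hpar i hi
    have b := hpar j hj
    rw [hij] at a
    have c1 := a.1.symm.trans b.1
    have c2 := a.2.symm.trans b.2
    clear a b hij hi hj hpar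
    revert i j
    decide) (by
    simp only [Fin.sum_univ_four]
    change -(s₀ * X 0 * X 1) + s₁ + s₂ * X 0 + s₃ * X 1 = 0
    rw [heq]; ring)
  refine ⟨?_, key 1, ?_, ?_⟩
  · have h : -(s₀ * X 0 * X 1) = 0 := key 0
    simpa [hX] using h
  · have h : s₂ * X 0 = 0 := key 2
    simpa [hX] using h
  · have h : s₃ * X 1 = 0 := key 3
    simpa [hX] using h
end

section
/- Let p₁, …, p_m be polynomials in ℝ[x₁,…,xₙ] = MvPolynomial (Fin n) ℝ and let j be a fixed variable index. If the polynomial Σᵢ pᵢ² becomes the zero polynomial after substituting x_j = 0, then each pᵢ is divisible by x_j; consequently Σᵢ pᵢ² = x_j² · q where q is again a sum of squares of polynomials. -/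
open MvPolynomial

lemma X_dvd_sub_subst (n : ℕ) (j : Fin n) (p : MvPolynomial (Fin n) ℝ) :
    X j ∣ p - aeval (fun i : Fin n => if i = j then (0 : MvPolynomial (Fin n) ℝ) else X i) p := by
  induction p using MvPolynomial.induction_on with
  | C a => simp [algebraMap_eq]
  | add p q hp hq =>
    rw [map_add, add_sub_add_comm]
    exact dvd_add hp hq
  | mul_X p i hp =>
    rw [map_mul, aeval_X]
    by_cases hi : i = j
    · simp [hi]
    · rw [if_neg hi, ← sub_mul]
      exact dvd_mul_of_dvd_left hp _

theorem stmt2 (n m : ℕ) (p : Fin m → MvPolynomial (Fin n) ℝ) (j : Fin n)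
    (h : aeval (fun i : Fin n => if i = j then 0 else X i)
        (∑ i, p i ^ 2) = (0 : MvPolynomial (Fin n) ℝ)) :
    (∀ i, X j ∣ p i) ∧
      ∃ q : MvPolynomial (Fin n) ℝ, IsSumOfSquares q ∧ ∑ i, p i ^ 2 = X j ^ 2 * q := by
  have hd : ∀ i, X j ∣ p i := by
    intro i
    have h0 : aeval (fun i : Fin n => if i = j then (0 : MvPolynomial (Fin n) ℝ) else X i)
        (p i) = 0 := by
      apply MvPolynomial.funext
      intro x
      have hx := congrArg (eval x) h
      rw [map_sum, map_sum, map_zero,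
        Finset.sum_eq_zero_iff_of_nonneg (fun k _ => by
          rw [map_pow, map_pow]; exact sq_nonneg _)] at hx
      have h2 := hx i (Finset.mem_univ i)
      rw [map_pow, map_pow] at h2
      rw [map_zero]
      exact pow_eq_zero_iff (two_ne_zero) |>.1 h2
    have h1 := X_dvd_sub_subst n j (p i)
    rwa [h0, sub_zero] at h1
  refine ⟨hd, ?_⟩
  choose t ht using hd
  refine ⟨∑ i, t i ^ 2, ⟨m, t, rfl⟩, ?_⟩
  rw [Finset.mul_sum]
  refine Finset.sum_congr rfl fun i _ => ?_
  rw [ht i, mul_pow]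
end

section
/- Let F = ℝ(x,y,z) be the field of fractions of the polynomial ring ℝ[x,y,z] in three variables. If s₀, s₁, …, s₇ ∈ F are each sums of squares of elements of F and they satisfy s₀·x·y + s₁·z = s₂ + s₃·x + s₄·y + s₅·x·z + s₆·y·z + s₇·x·y·z, then sᵢ = 0 for all i = 0, …, 7. -/
open MvPolynomial

/-- `F = ℝ(x,y,z)`, the field of fractions of `ℝ[x,y,z]`. -/
noncomputable abbrev F3 : Type := FractionRing (MvPolynomial (Fin 3) ℝ)

/-- The image of the variable `x` in `F = ℝ(x,y,z)`. -/
noncomputable def F3x : F3 := algebraMap (MvPolynomial (Fin 3) ℝ) F3 (X 0)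

/-- The image of the variable `y` in `F = ℝ(x,y,z)`. -/
noncomputable def F3y : F3 := algebraMap (MvPolynomial (Fin 3) ℝ) F3 (X 1)

/-- The image of the variable `z` in `F = ℝ(x,y,z)`. -/
noncomputable def F3z : F3 := algebraMap (MvPolynomial (Fin 3) ℝ) F3 (X 2)

/-- A nonzero sum of squares of polynomials has even degree. -/
lemma sos_degree_even {σ : Type*} (m : MonomialOrder σ) {n : ℕ} (q : Fin n → MvPolynomial σ ℝ)
    (h : ∑ j, q j ^ 2 ≠ 0) : ∃ d, m.degree (∑ j, q j ^ 2) = d + d := by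
  classical
  have hex : ∃ j, q j ≠ 0 := by
    by_contra! hc
    exact h (by simp [hc])
  obtain ⟨j0, hj0⟩ := hex
  obtain ⟨i, hi, hmax⟩ := Finset.exists_max_image
    (Finset.univ.filter fun j => q j ≠ 0) (fun j => m.toSyn (m.degree (q j)))
    ⟨j0, by simp [hj0]⟩
  have hi' : q i ≠ 0 := by simpa using hi
  set d := m.degree (q i) with hd
  have hle : ∀ j, m.toSyn (m.degree (q j)) ≤ m.toSyn d := by
    intro j
    by_cases hj : q j = 0
    · simp [hj]
    · exact hmax j (by simp [hj])
  refine ⟨d, ?_⟩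
  have hsq : ∀ j, m.toSyn (m.degree (q j ^ 2)) ≤ m.toSyn (d + d) := by
    intro j
    rw [pow_two]
    refine le_trans m.degree_mul_le ?_
    rw [map_add, map_add]
    exact add_le_add (hle j) (hle j)
  have hcoeff : (∑ j, q j ^ 2).coeff (d + d) ≠ 0 := by
    rw [coeff_sum]
    have : ∀ j, (q j ^ 2).coeff (d + d) = ((q j).coeff d) ^ 2 := by
      intro j
      rw [pow_two, pow_two]
      exact m.coeff_mul_of_add_of_degree_le (hle j) (hle j)
    simp only [this]
    have hpos : 0 < ((q i).coeff d) ^ 2 := by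
      have : (q i).coeff d ≠ 0 := m.coeff_degree_ne_zero_iff.mpr hi'
      positivity
    exact (lt_of_lt_of_le hpos (Finset.single_le_sum (f := fun j => ((q j).coeff d) ^ 2)
      (fun j _ => sq_nonneg _) (Finset.mem_univ i))).ne'
  apply m.toSyn.injective
  apply le_antisymm
  · refine le_trans m.degree_sum_le ?_
    exact Finset.sup_le fun j _ => hsq j
  · exact m.le_degree (mem_support_iff.mpr hcoeff)

lemma poly_main {σ ι : Type*} [Fintype ι] (m : MonomialOrder σ) (e : ι → σ →₀ ℕ) (c : ι → ℝ)
    (hc : ∀ i, c i ≠ 0) (he : ∀ i j, (∀ k, e i k % 2 = e j k % 2) → i = j)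
    (p : ι → MvPolynomial σ ℝ)
    (hp : ∀ i, p i ≠ 0 → ∃ d, m.degree (p i) = d + d)
    (hsum : ∑ i, monomial (e i) (c i) * p i = 0) : ∀ i, p i = 0 := by
  classical
  by_contra! hne
  obtain ⟨i0, hi0⟩ := hne
  obtain ⟨i, hi, hmax⟩ := Finset.exists_max_image
    (Finset.univ.filter fun j => p j ≠ 0) (fun j => m.toSyn (e j + m.degree (p j)))
    ⟨i0, by simp [hi0]⟩
  have hi' : p i ≠ 0 := by simpa using hi
  have h0 := congrArg (coeff (e i + m.degree (p i))) hsum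
  rw [coeff_sum, Finset.sum_eq_single i, coeff_monomial_mul] at h0
  · simp only [coeff_zero, mul_eq_zero] at h0
    exact h0.elim (hc i) (m.coeff_degree_ne_zero_iff.mpr hi')
  · intro j _ hji
    by_contra hcj
    have hj : p j ≠ 0 := by
      rintro h
      simp [h] at hcj
    have h1 := m.le_degree (mem_support_iff.mpr hcj)
    have hm : (monomial (e j) (c j)) ≠ (0 : MvPolynomial σ ℝ) := by simpa using hc j
    rw [m.degree_mul hm hj, m.degree_monomial, if_neg (hc j)] at h1
    have h2 := m.toSyn.injective (le_antisymm h1 (hmax j (by simp [hj])))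
    obtain ⟨a, ha⟩ := hp i hi'
    obtain ⟨b, hb⟩ := hp j hj
    rw [ha, hb] at h2
    refine hji (he j i fun k => ?_)
    have := DFunLike.congr_fun h2 k
    simp only [Finsupp.add_apply] at this
    omega
  · simp

theorem stmt3 (s : Fin 8 → F3) (hs : ∀ i, IsSumOfSquares (s i))
    (heq : s 0 * F3x * F3y + s 1 * F3z =
        s 2 + s 3 * F3x + s 4 * F3y + s 5 * F3x * F3z + s 6 * F3y * F3z
          + s 7 * F3x * F3y * F3z) :
    ∀ i, s i = 0 := by
  choose n t ht using hs
  obtain ⟨b, hb⟩ := IsLocalization.exist_integer_multiples_of_finite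
    (nonZeroDivisors (MvPolynomial (Fin 3) ℝ)) (fun a : (Σ i, Fin (n i)) => t a.1 a.2)
  choose q hq using hb
  set A := algebraMap (MvPolynomial (Fin 3) ℝ) F3 with hA
  set p : Fin 8 → MvPolynomial (Fin 3) ℝ := fun i => ∑ j, q ⟨i, j⟩ ^ 2 with hpdef
  have hAp : ∀ i, A (p i) = A b ^ 2 * s i := by
    intro i
    rw [ht i, Finset.mul_sum, hpdef, map_sum]
    refine Finset.sum_congr rfl fun j _ => ?_
    rw [map_pow, hq, Algebra.smul_def, mul_pow]
  have hAinj : Function.Injective A := IsFractionRing.injective _ _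
  have hb0 : A b ≠ 0 := by
    rw [Ne, map_eq_zero_iff A hAinj]
    exact nonZeroDivisors.coe_ne_zero b
  let v : Fin 3 → Fin 3 →₀ ℕ := fun k => Finsupp.single k 1
  have hmain : ∀ i, p i = 0 := by
    refine poly_main MonomialOrder.lex
      ![v 0 + v 1, v 2, 0, v 0, v 1, v 0 + v 2, v 1 + v 2, v 0 + v 1 + v 2]
      ![1, 1, -1, -1, -1, -1, -1, -1] ?_ ?_ p (fun i hi => sos_degree_even _ _ hi) ?_
    · intro i
      fin_cases i <;> simp
    · intro i j h
      have h0 := h 0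
      have h1 := h 1
      have h2 := h 2
      clear h
      revert h0 h1 h2
      fin_cases i <;> fin_cases j <;> simp [v, Finsupp.single_apply]
    · apply hAinj
      have hv : ∀ k (a : Fin 3 →₀ ℕ) (r : ℝ), monomial (a + v k) r = monomial a r * X k := by
        intro k a r
        simp [v, X, monomial_mul]
      have hv0 : ∀ k (r : ℝ), monomial (v k) r = C r * X k := by
        intro k r
        rw [← zero_add (v k), hv]; rfl
      have h00 : ∀ r : ℝ, monomial (0 : Fin 3 →₀ ℕ) r = C r := fun r => rfl
      simp only [Fin.sum_univ_eight]
      simp [hv, hv0, h00, hAp]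
      simp only [F3x, F3y, F3z, ← hA] at heq
      linear_combination (A b ^ 2) * heq
  intro i
  have := hAp i
  rw [hmain i, map_zero] at this
  exact (mul_eq_zero.mp this.symm).resolve_left (pow_ne_zero 2 hb0)
end

section
/- If s₀, s₁, …, s₇ ∈ ℝ[x,y,z] are each sums of squares of polynomials and they satisfy s₀·x·y + s₁·z = s₂ + s₃·x + s₄·y + s₅·x·z + s₆·y·z + s₇·x·y·z, then sᵢ = 0 for all i = 0, …, 7. -/
open MvPolynomial

/-- Zero, or positive leading coefficient and even leading exponent. -/
def GoodLead (m : MonomialOrder (Fin 3)) (p : MvPolynomial (Fin 3) ℝ) : Prop :=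
  p = 0 ∨ (0 < m.leadingCoeff p ∧ ∃ d, m.degree p = d + d)

theorem GoodLead.add_lt {m : MonomialOrder (Fin 3)} {p q : MvPolynomial (Fin 3) ℝ}
    (hp : GoodLead m p) (h : m.toSyn (m.degree q) < m.toSyn (m.degree p)) :
    GoodLead m (p + q) := by
  rcases hp with rfl | ⟨hp, d, hd⟩
  · simp at h
    exact absurd h (not_lt.mpr (m.zero_le _))
  · right
    rw [m.leadingCoeff_add_of_lt h, m.degree_add_of_lt h]
    exact ⟨hp, d, hd⟩

theorem GoodLead.add {m : MonomialOrder (Fin 3)} {p q : MvPolynomial (Fin 3) ℝ}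
    (hp : GoodLead m p) (hq : GoodLead m q) : GoodLead m (p + q) := by
  rcases lt_trichotomy (m.toSyn (m.degree q)) (m.toSyn (m.degree p)) with h | h | h
  · exact hp.add_lt h
  · rcases hp with rfl | ⟨hp, d, hd⟩
    · simpa using hq
    rcases hq with rfl | ⟨hq, d', hd'⟩
    · right; simpa using ⟨hp, d, hd⟩
    have h' : m.degree q = m.degree p := m.toSyn.injective h
    have hc : (p + q).coeff (m.degree p) = m.leadingCoeff p + m.leadingCoeff q := by
      rw [coeff_add, MonomialOrder.leadingCoeff, MonomialOrder.leadingCoeff, h']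
    have hdeg : m.degree (p + q) = m.degree p := by
      apply m.toSyn.injective
      apply le_antisymm
      · refine m.degree_add_le.trans ?_
        rw [h]; simp
      · apply m.le_degree
        rw [mem_support_iff, hc]
        positivity
    right
    refine ⟨?_, d, hdeg.trans hd⟩
    rw [MonomialOrder.leadingCoeff, hdeg, hc]
    positivity
  · rw [add_comm]; exact hq.add_lt h

theorem goodLead_sq (m : MonomialOrder (Fin 3)) (p : MvPolynomial (Fin 3) ℝ) :
    GoodLead m (p ^ 2) := by
  by_cases hp : p = 0
  · left; simp [hp]
  · right
    rw [sq, m.leadingCoeff_mul, m.degree_mul hp hp]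
    have : m.leadingCoeff p ≠ 0 := m.leadingCoeff_ne_zero_iff.mpr hp
    exact ⟨mul_self_pos.mpr this, _, rfl⟩

theorem goodLead_of_sos (m : MonomialOrder (Fin 3)) {p : MvPolynomial (Fin 3) ℝ}
    (hp : IsSumOfSquares p) : GoodLead m p := by
  obtain ⟨n, t, rfl⟩ := hp
  exact Finset.sum_induction _ (GoodLead m) (fun _ _ => GoodLead.add) (Or.inl rfl)
    (fun i _ => goodLead_sq m (t i))

/-- Exponents of the eight weights. -/
def wt : Fin 8 → Fin 3 → ℕ :=
  ![![1, 1, 0], ![0, 0, 1], ![0, 0, 0], ![1, 0, 0], ![0, 1, 0], ![1, 0, 1], ![0, 1, 1], ![1, 1, 1]]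

/-- Signs of the eight weights. -/
def sg : Fin 8 → ℝ := ![1, 1, -1, -1, -1, -1, -1, -1]

theorem stmt4 (s : Fin 8 → MvPolynomial (Fin 3) ℝ) (hs : ∀ i, IsSumOfSquares (s i))
    (heq : s 0 * X 0 * X 1 + s 1 * X 2 =
        s 2 + s 3 * X 0 + s 4 * X 1 + s 5 * X 0 * X 2 + s 6 * X 1 * X 2
          + s 7 * X 0 * X 1 * X 2) :
    ∀ i, s i = 0 := by
  classical
  let m : MonomialOrder (Fin 3) := MonomialOrder.lex
  let e : Fin 8 → (Fin 3 →₀ ℕ) := fun i => Finsupp.equivFunOnFinite.symm (wt i)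
  let f : Fin 8 → MvPolynomial (Fin 3) ℝ := fun i => s i * monomial (e i) (sg i)
  have hsg : ∀ i, sg i ≠ 0 := by
    intro i; fin_cases i <;> simp [sg]
  have hsum : ∑ i, f i = 0 := by
    simp only [Fin.sum_univ_eight, f, monomial_eq, e, Finsupp.prod_fintype, pow_zero,
      implies_true, Fin.prod_univ_three]
    simp [wt, sg]
    linear_combination heq
  have hmon : ∀ i, monomial (e i) (sg i) ≠ 0 := fun i => by simpa using hsg i
  have hdeg : ∀ i, s i ≠ 0 → ∃ d, m.degree (f i) = d + d + e i := by
    intro i hi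
    rcases goodLead_of_sos m (hs i) with h | ⟨-, d, hd⟩
    · exact absurd h hi
    · refine ⟨d, ?_⟩
      simp only [f]
      rw [m.degree_mul hi (hmon i), hd, m.degree_monomial, if_neg (hsg i)]
  have hwt : ∀ i j : Fin 8, (∀ k, wt i k % 2 = wt j k % 2) → i = j := by decide
  by_contra! hne
  obtain ⟨i0, hi0⟩ := hne
  obtain ⟨i, hi, hmax⟩ := Finset.exists_max_image (Finset.univ.filter fun i => s i ≠ 0)
    (fun i => m.toSyn (m.degree (f i))) ⟨i0, by simpa using hi0⟩
  have hi : s i ≠ 0 := by simpa using hi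
  have hc := congrArg (coeff (m.degree (f i))) hsum
  rw [coeff_sum, Finset.sum_eq_single i] at hc
  · exact m.leadingCoeff_ne_zero_iff.mpr (mul_ne_zero hi (hmon i)) hc
  · intro j _ hji
    by_cases hj : s j = 0
    · simp [f, hj]
    apply m.coeff_eq_zero_of_lt
    refine lt_of_le_of_ne (hmax j (by simpa using hj)) fun h => hji (hwt _ _ fun k => ?_)
    have h := m.toSyn.injective h
    obtain ⟨d, hd⟩ := hdeg i hi
    obtain ⟨d', hd'⟩ := hdeg j hj
    rw [hd, hd'] at h
    have := DFunLike.congr_fun h k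
    simp [e] at this
    omega
  · simp
end

section
/- Let F = ℝ(x,y,z) be the field of fractions of ℝ[x,y,z], let τ : F ≃ F be the field automorphism induced by the cyclic permutation x ↦ y ↦ z ↦ x of the variables, and let L = ℝ(x², y², z², x·y·z) ⊆ F. Let X ∈ M₃(F) be the matrix with entries X₀₂ = z, X₁₀ = x, X₂₁ = y and all other entries 0, and for l ∈ F let D(l) = diag(l, τ(l), τ²(l)). Suppose Y = Σₖ Zₖ · Zₖᵀ where each Zₖ = D(aₖ) + D(bₖ)·X + D(cₖ)·Xᵀ with aₖ, bₖ, cₖ ∈ L. Then the (0,0) entry of Y satisfies Y₀₀ = s₁ + z²·s₂ + x²·s₃ for some elements s₁, s₂, s₃ of L that are sums of squares of elements of L. -/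
open MvPolynomial Matrix

/-- The field automorphism `τ` of `F = ℝ(x,y,z)` induced by the cyclic permutation of the
variables `x ↦ y, y ↦ z, z ↦ x`, i.e. the unique extension to `F` of the ring automorphism
of `ℝ[x,y,z]` renaming the variables along the cycle `(x y z)` (namely `rename (finRotate 3)`,
which sends `X i` to `X (i+1)`). -/
noncomputable def τ : F3 ≃ₐ[ℝ] F3 :=
  IsFractionRing.algEquivOfAlgEquiv (MvPolynomial.renameEquiv ℝ (finRotate 3))

/-- `L = ℝ(x², y², z², xyz)` as an intermediate field of `F/ℝ`. -/
noncomputable def L : IntermediateField ℝ F3 :=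
  IntermediateField.adjoin ℝ {F3x ^ 2, F3y ^ 2, F3z ^ 2, F3x * F3y * F3z}

/-- The matrix `X` with entries `X₀₂ = z`, `X₁₀ = x`, `X₂₁ = y` and all other entries `0`. -/
noncomputable def Xmat : Matrix (Fin 3) (Fin 3) F3 :=
  !![0, 0, F3z; F3x, 0, 0; 0, F3y, 0]

/-- For `l ∈ F`, the diagonal matrix `D(l) = diag(l, τ(l), τ²(l))`. -/
noncomputable def D (l : F3) : Matrix (Fin 3) (Fin 3) F3 :=
  Matrix.diagonal ![l, τ l, τ (τ l)]

/-- `s` is a (finite) sum of squares of elements of the intermediate field `M`. -/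
def IsSumOfSquaresIn (M : IntermediateField ℝ F3) (s : F3) : Prop :=
  ∃ (n : ℕ) (t : Fin n → F3), (∀ i, t i ∈ M) ∧ s = ∑ i, t i ^ 2

theorem stmt8 (Y : Matrix (Fin 3) (Fin 3) F3) (m : ℕ)
    (a b c : Fin m → F3) (ha : ∀ k, a k ∈ L) (hb : ∀ k, b k ∈ L) (hc : ∀ k, c k ∈ L)
    (hY : Y = ∑ k, (D (a k) + D (b k) * Xmat + D (c k) * Xmatᵀ) *
                   (D (a k) + D (b k) * Xmat + D (c k) * Xmatᵀ)ᵀ) :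
    ∃ s₁ s₂ s₃ : F3,
      IsSumOfSquaresIn L s₁ ∧ IsSumOfSquaresIn L s₂ ∧ IsSumOfSquaresIn L s₃ ∧
      Y 0 0 = s₁ + F3z ^ 2 * s₂ + F3x ^ 2 * s₃ := by
  refine ⟨∑ k, a k ^ 2, ∑ k, b k ^ 2, ∑ k, c k ^ 2, ⟨m, a, ha, rfl⟩, ⟨m, b, hb, rfl⟩,
    ⟨m, c, hc, rfl⟩, ?_⟩
  subst hY
  rw [Matrix.sum_apply, Finset.mul_sum, Finset.mul_sum, ← Finset.sum_add_distrib,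
    ← Finset.sum_add_distrib]
  refine Finset.sum_congr rfl fun k _ => ?_
  simp only [Matrix.mul_apply, Fin.sum_univ_three, Matrix.transpose_apply, Matrix.add_apply,
    D, Matrix.diagonal_mul, Xmat]
  simp [Matrix.diagonal_apply]
  ring
end

section
/- Let R be a (not necessarily commutative) ring with involution * (a star ring), and let e ∈ R satisfy: (i) e = e*e² + e²e* + ee*e, (ii) e³e* = e*e³, and (iii) e·(e*)²·e = e*·e²·e*. Then e*e·ee* = (e³)*·e³ + (e²e*)*·(e²e*) + ((e*)²e)*·((e*)²e); in particular, e*e·ee* is a sum of three hermitian squares a*a in R. -/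
theorem key10 {R : Type*} [Ring R] (x y : R)
    (h1 : x = y * x ^ 2 + x ^ 2 * y + x * y * x)
    (h2 : x ^ 3 * y = y * x ^ 3)
    (h3 : x * y ^ 2 * x = y * x ^ 2 * y) :
    y * x * (x * y) = y ^ 3 * x ^ 3 + (x * y ^ 2) * (x ^ 2 * y) + (y * x ^ 2) * (y ^ 2 * x) := by
  calc y * x * (x * y)
      = y * (y * x ^ 2 + x ^ 2 * y + x * y * x) * (x * y) := by rw [← h1]
    _ = y ^ 2 * (x ^ 3 * y) + (y * x ^ 2 * y) * (x * y) + (y * x) * (y * x ^ 2 * y) := by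
        noncomm_ring
    _ = y ^ 2 * (y * x ^ 3) + (x * y ^ 2 * x) * (x * y) + (y * x) * (x * y ^ 2 * x) := by
        rw [h2, h3]
    _ = _ := by noncomm_ring

theorem stmt10 {R : Type*} [Ring R] [StarRing R] (e : R)
    (h1 : e = star e * e ^ 2 + e ^ 2 * star e + e * star e * e)
    (h2 : e ^ 3 * star e = star e * e ^ 3)
    (h3 : e * star e ^ 2 * e = star e * e ^ 2 * star e) :
    star e * e * (e * star e) =
        star (e ^ 3) * e ^ 3 + star (e ^ 2 * star e) * (e ^ 2 * star e)
          + star (star e ^ 2 * e) * (star e ^ 2 * e) ∧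
      ∃ a : Fin 3 → R, star e * e * (e * star e) = ∑ i, star (a i) * a i := by
  have H : star e * e * (e * star e) =
        star (e ^ 3) * e ^ 3 + star (e ^ 2 * star e) * (e ^ 2 * star e)
          + star (star e ^ 2 * e) * (star e ^ 2 * e) := by
    simp only [star_mul, star_pow, star_star]
    exact key10 e (star e) h1 h2 h3
  refine ⟨H, ![e ^ 3, e ^ 2 * star e, star e ^ 2 * e], ?_⟩
  rw [H, Fin.sum_univ_three]
  rfl
end

section
/- Let v₁, v₂, v₃ ∈ ℝ with v₁² + v₂² + v₃² = 1, and let M be the complex 3×3 matrix with entries M₀₂ = i·v₃, M₁₀ = v₁, M₂₁ = v₂, and all other entries 0; let M* denote its conjugate transpose. Then M satisfies the defining relations of the *-algebra related to the extended Dynkin diagram Ẽ₆ in the centered generator: M³ + (M*)³ = 0, M²M* + MM*M + M*M² = M, and (M*)²M + M*MM* + M(M*)² = M*. -/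
open Matrix

theorem stmt11 (v₁ v₂ v₃ : ℝ) (hv : v₁ ^ 2 + v₂ ^ 2 + v₃ ^ 2 = 1)
    (M : Matrix (Fin 3) (Fin 3) ℂ)
    (hM : M = !![0, 0, Complex.I * (v₃ : ℂ); (v₁ : ℂ), 0, 0; 0, (v₂ : ℂ), 0]) :
    M ^ 3 + Mᴴ ^ 3 = 0 ∧
    M ^ 2 * Mᴴ + M * Mᴴ * M + Mᴴ * M ^ 2 = M ∧
    Mᴴ ^ 2 * M + Mᴴ * M * Mᴴ + M * Mᴴ ^ 2 = Mᴴ := by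
  have hc : (v₁ : ℂ) ^ 2 + (v₂ : ℂ) ^ 2 + (v₃ : ℂ) ^ 2 = 1 := by exact_mod_cast hv
  have hI : Complex.I ^ 2 = -1 := Complex.I_sq
  have hH : Mᴴ = !![0, (v₁ : ℂ), 0; 0, 0, (v₂ : ℂ); -(Complex.I * (v₃ : ℂ)), 0, 0] := by
    subst hM
    ext i j
    fin_cases i <;> fin_cases j <;> simp [Matrix.conjTranspose_apply]
  rw [hH, hM]
  generalize Complex.I = I at *
  refine ⟨?_, ?_, ?_⟩
  all_goals
    ext i j
    fin_cases i <;> fin_cases j <;>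
      simp [pow_succ, Matrix.mul_apply, Fin.sum_univ_three] <;> grind
end
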